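/- arXiv:1703.02820 — 7 statements merged into one kernel-verified Lean document; each statement's English description precedes it below -/
import Mathlib

section
/- For every x ∈ [0,1), f(x) = 3/2 − x − 3·f12(x). -/
/-- The `n`-th ternary digit of `x` (n = 0,1,2,...). -/
noncomputable def terDigit (n : ℕ) (x : ℝ) : ℤ := ⌊(3:ℝ)^(n+1) * x⌋ % 3

/-- φ(i) = (−3i² + 7i)/2, so φ(0)=0, φ(1)=2, φ(2)=1. -/
noncomputable def phi (i : ℤ) : ℝ := (-3*(i:ℝ)^2 + 7*(i:ℝ))/2

/-- φ01(i) = (i² − i)/2. -/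
noncomputable def phi01 (i : ℤ) : ℝ := ((i:ℝ)^2 - (i:ℝ))/2

/-- φ02(i) = −i² + 2i. -/
noncomputable def phi02 (i : ℤ) : ℝ := -(i:ℝ)^2 + 2*(i:ℝ)

/-- φ12(i) = (i² − 3i + 2)/2. -/
noncomputable def phi12 (i : ℤ) : ℝ := ((i:ℝ)^2 - 3*(i:ℝ) + 2)/2

/-- f(x) = ∑ φ(d_n(x))/3^(n+1). -/
noncomputable def f (x : ℝ) : ℝ := ∑' n : ℕ, phi (terDigit n x) / 3^(n+1)

noncomputable def f01 (x : ℝ) : ℝ := ∑' n : ℕ, phi01 (terDigit n x) / 3^(n+1)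

noncomputable def f02 (x : ℝ) : ℝ := ∑' n : ℕ, phi02 (terDigit n x) / 3^(n+1)

noncomputable def f12 (x : ℝ) : ℝ := ∑' n : ℕ, phi12 (terDigit n x) / 3^(n+1)

/-- `x` is ternary-irrational: `3^n x` is never an integer. -/
def TernaryIrrational (x : ℝ) : Prop := ∀ n : ℕ, ¬ ∃ k : ℤ, (3:ℝ)^n * x = (k:ℝ)

lemma natCast_digits_three {x : ℝ} (hx : 0 ≤ x) (n : ℕ) :
    ((Real.digits x 3 n : ℕ) : ℤ) = terDigit n x := by
  have h : (0 : ℝ) ≤ 3 ^ (n + 1) * x := by positivity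
  rw [terDigit, ← Int.natCast_floor_eq_floor h, Real.digits, Fin.val_ofNat, mul_comm x]
  push_cast
  rfl

lemma hasSum_terDigit {x : ℝ} (hx : x ∈ Set.Ico (0 : ℝ) 1) :
    HasSum (fun n ↦ (terDigit n x : ℝ) / 3 ^ (n + 1)) x := by
  refine (Real.hasSum_ofDigitsTerm_digits x (b := 3) (by norm_num) hx).congr_fun fun n ↦ ?_
  rw [Real.ofDigitsTerm, ← natCast_digits_three hx.1 n]
  push_cast
  rw [div_eq_mul_inv]

lemma phi12_terDigit_mem_Icc (n : ℕ) (x : ℝ) : phi12 (terDigit n x) ∈ Set.Icc (0 : ℝ) 1 := by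
  have h : terDigit n x = 0 ∨ terDigit n x = 1 ∨ terDigit n x = 2 := by
    unfold terDigit
    omega
  rcases h with h | h | h <;> rw [h] <;> norm_num [phi12]

lemma hasSum_three_div_three_pow : HasSum (fun n : ℕ ↦ (3 : ℝ) / 3 ^ (n + 1)) (3 / 2) := by
  convert hasSum_geometric_of_lt_one (r := (1 / 3 : ℝ)) (by norm_num) (by norm_num) using 1
  · ext n
    rw [pow_succ, one_div, inv_pow]
    field_simp
  · norm_num

lemma summable_phi12_terDigit (x : ℝ) :
    Summable fun n ↦ phi12 (terDigit n x) / 3 ^ (n + 1) := by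
  refine hasSum_three_div_three_pow.summable.of_nonneg_of_le
    (fun n ↦ div_nonneg (phi12_terDigit_mem_Icc n x).1 (by positivity)) fun n ↦ ?_
  gcongr
  linarith [(phi12_terDigit_mem_Icc n x).2]

theorem stmt_1 : ∀ x ∈ Set.Ico (0:ℝ) 1, f x = 3/2 - x - 3 * f12 x := by
  intro x hx
  rw [f, f12, ← ((hasSum_three_div_three_pow.sub (hasSum_terDigit hx)).sub
    ((summable_phi12_terDigit x).hasSum.mul_left 3)).tsum_eq]
  refine tsum_congr fun n ↦ ?_
  rw [phi, phi12]
  ring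
end

section
/- The function f is not injective, but it fails to be injective only on a countable set: the set G = {x ∈ [0,1) : there exists y ∈ [0,1) with y ≠ x and f(y) = f(x)} is nonempty and countable. -/
lemma phi_terDigit_cases (n : ℕ) (x : ℝ) :
    phi (terDigit n x) = 0 ∨ phi (terDigit n x) = 1 ∨ phi (terDigit n x) = 2 := by
  have h : terDigit n x = 0 ∨ terDigit n x = 1 ∨ terDigit n x = 2 := by
    unfold terDigit; omega
  rcases h with h | h | h <;> rw [h] <;> norm_num [phi]

lemma phi_terDigit_nonneg (n : ℕ) (x : ℝ) : 0 ≤ phi (terDigit n x) / 3 ^ (n + 1) := by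
  rcases phi_terDigit_cases n x with h | h | h <;> rw [h] <;> positivity

lemma phi_terDigit_le (n : ℕ) (x : ℝ) :
    phi (terDigit n x) / 3 ^ (n + 1) ≤ 2 / 3 * (1 / 3 : ℝ) ^ n := by
  have h : phi (terDigit n x) ≤ 2 := by
    rcases phi_terDigit_cases n x with h | h | h <;> rw [h] <;> norm_num
  calc phi (terDigit n x) / 3 ^ (n + 1) ≤ 2 / 3 ^ (n + 1) := by gcongr
    _ = 2 / 3 * (1 / 3 : ℝ) ^ n := by rw [one_div, inv_pow, pow_succ]; field_simp

lemma hasSum_two_thirds_mul_geometric :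
    HasSum (fun n : ℕ => 2 / 3 * (1 / 3 : ℝ) ^ n) 1 := by
  have h := (hasSum_geometric_of_lt_one (r := (1 / 3 : ℝ)) (by norm_num) (by norm_num)).mul_left
    (2 / 3)
  norm_num at h
  simpa using h

lemma summable_phi_terDigit (x : ℝ) :
    Summable fun n : ℕ => phi (terDigit n x) / 3 ^ (n + 1) :=
  .of_nonneg_of_le (phi_terDigit_nonneg · x) (phi_terDigit_le · x)
    hasSum_two_thirds_mul_geometric.summable

lemma f_nonneg (x : ℝ) : 0 ≤ f x := tsum_nonneg (phi_terDigit_nonneg · x)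

lemma f_le_one (x : ℝ) : f x ≤ 1 :=
  hasSum_le (phi_terDigit_le · x) (summable_phi_terDigit x).hasSum hasSum_two_thirds_mul_geometric

lemma terDigit_fract (n : ℕ) (x : ℝ) :
    terDigit n (Int.fract (3 * x)) = terDigit (n + 1) x := by
  unfold terDigit
  have h : (3 : ℝ) ^ (n + 1) * Int.fract (3 * x)
      = 3 ^ (n + 1 + 1) * x - ((3 * (3 ^ n * ⌊3 * x⌋) : ℤ) : ℝ) := by
    rw [Int.fract]; push_cast; ring
  rw [h, Int.floor_sub_intCast]
  omega

lemma f_eq (x : ℝ) : f x = (phi (terDigit 0 x) + f (Int.fract (3 * x))) / 3 := by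
  rw [f, (summable_phi_terDigit x).tsum_eq_zero_add, add_div, f, ← tsum_div_const]
  simp only [terDigit_fract]
  congr 1
  · norm_num
  · congr 1; ext n; rw [pow_succ (3 : ℝ) (n + 1), div_div]

lemma terDigit_zero_of_mem {x : ℝ} (hx : x ∈ Set.Ico (0 : ℝ) 1) :
    (terDigit 0 x = 0 ∨ terDigit 0 x = 1 ∨ terDigit 0 x = 2) ∧
      Int.fract (3 * x) = 3 * x - terDigit 0 x := by
  have h0 : 0 ≤ ⌊3 * x⌋ := Int.floor_nonneg.2 (by linarith [hx.1])
  have h3 : ⌊3 * x⌋ < 3 := Int.floor_lt.2 (by push_cast; linarith [hx.2])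
  have h : terDigit 0 x = ⌊3 * x⌋ := by
    simp only [terDigit, zero_add, pow_one]; omega
  exact ⟨by omega, by rw [h, Int.fract]⟩

lemma fract_mem (x : ℝ) : Int.fract x ∈ Set.Ico (0 : ℝ) 1 :=
  ⟨Int.fract_nonneg x, Int.fract_lt_one x⟩

lemma f_eq_cases {x : ℝ} (hx : x ∈ Set.Ico (0 : ℝ) 1) :
    (Int.fract (3 * x) = 3 * x ∧ f x = f (Int.fract (3 * x)) / 3) ∨
    (Int.fract (3 * x) = 3 * x - 1 ∧ f x = (2 + f (Int.fract (3 * x))) / 3) ∨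
    (Int.fract (3 * x) = 3 * x - 2 ∧ f x = (1 + f (Int.fract (3 * x))) / 3) := by
  obtain ⟨h, e⟩ := terDigit_zero_of_mem hx
  have hf := f_eq x
  rcases h with h | h | h
  · left; rw [h] at e hf; norm_num [phi] at e hf; exact ⟨by simpa using e, hf⟩
  · right; left; rw [h] at e hf; norm_num [phi] at e hf; exact ⟨by simpa using e, hf⟩
  · right; right; rw [h] at e hf; norm_num [phi] at e hf; exact ⟨by simpa using e, hf⟩

lemma eq_zero_of_forall_three_pow_mul_le {a : ℝ} (ha : 0 ≤ a)
    (h : ∀ n : ℕ, (3 : ℝ) ^ n * a ≤ 1) : a = 0 := by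
  by_contra hne
  have hpos : 0 < a := lt_of_le_of_ne ha (Ne.symm hne)
  obtain ⟨n, hn⟩ := pow_unbounded_of_one_lt (1 / a) (by norm_num : (1 : ℝ) < 3)
  rw [div_lt_iff₀ hpos] at hn
  linarith [h n]

lemma eq_zero_of_f_eq_zero {z : ℝ} (hz : z ∈ Set.Ico (0 : ℝ) 1) (h : f z = 0) : z = 0 := by
  refine eq_zero_of_forall_three_pow_mul_le hz.1 fun n => ?_
  induction n generalizing z with
  | zero => linarith [hz.2]
  | succ n ih =>
    have h0 := f_nonneg (Int.fract (3 * z))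
    rcases f_eq_cases hz with ⟨e, hf⟩ | ⟨-, hf⟩ | ⟨-, hf⟩
    · have := ih (fract_mem _) (by linarith)
      rw [e] at this
      rw [pow_succ]; linarith
    all_goals linarith

lemma eq_half_of_f_eq_one {z : ℝ} (hz : z ∈ Set.Ico (0 : ℝ) 1) (h : f z = 1) : z = 1 / 2 := by
  rw [← sub_eq_zero, ← abs_eq_zero]
  refine eq_zero_of_forall_three_pow_mul_le (abs_nonneg _) fun n => ?_
  induction n generalizing z with
  | zero => rw [pow_zero, one_mul, abs_le]; constructor <;> linarith [hz.1, hz.2]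
  | succ n ih =>
    have h0 := f_le_one (Int.fract (3 * z))
    rcases f_eq_cases hz with ⟨-, hf⟩ | ⟨e, hf⟩ | ⟨-, hf⟩
    · linarith
    · have := ih (fract_mem _) (by linarith)
      rw [e, show 3 * z - 1 - 1 / 2 = 3 * (z - 1 / 2) by ring, abs_mul,
        abs_of_pos (by norm_num : (0 : ℝ) < 3)] at this
      rw [pow_succ]; linarith
    · linarith

lemma mem_range_ratCast_of_fract {x : ℝ} (h : Int.fract (3 * x) ∈ Set.range ((↑) : ℚ → ℝ)) :
    x ∈ Set.range ((↑) : ℚ → ℝ) := by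
  obtain ⟨q, hq⟩ := h
  refine ⟨(q + ⌊3 * x⌋) / 3, ?_⟩
  have := Int.fract_add_floor (3 * x)
  push_cast
  rw [hq]; linarith

lemma mem_range_ratCast_of_f_eq_zero_or_one {z : ℝ} (hz : z ∈ Set.Ico (0 : ℝ) 1)
    (h : f z = 0 ∨ f z = 1) : z ∈ Set.range ((↑) : ℚ → ℝ) := by
  rcases h with h | h
  · exact ⟨0, by simp [eq_zero_of_f_eq_zero hz h]⟩
  · exact ⟨1 / 2, by simp [eq_half_of_f_eq_one hz h]⟩

/-- Applying `x ↦ fract (3 * x)` to two points with the same image under `f`, not both of which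
are rational, preserves the equality of the images and triples the distance. -/
lemma f_fract_eq_of_f_eq {x y : ℝ} (hx : x ∈ Set.Ico (0 : ℝ) 1) (hy : y ∈ Set.Ico (0 : ℝ) 1)
    (h : f x = f y) (hirr : x ∉ Set.range ((↑) : ℚ → ℝ)) :
    f (Int.fract (3 * x)) = f (Int.fract (3 * y)) ∧
      Int.fract (3 * x) - Int.fract (3 * y) = 3 * (x - y) := by
  have hx0 := f_nonneg (Int.fract (3 * x))
  have hx1 := f_le_one (Int.fract (3 * x))
  have hy0 := f_nonneg (Int.fract (3 * y))
  have hy1 := f_le_one (Int.fract (3 * y))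
  have hne : ¬ (f (Int.fract (3 * x)) = 0 ∨ f (Int.fract (3 * x)) = 1) := fun h' =>
    hirr (mem_range_ratCast_of_fract (mem_range_ratCast_of_f_eq_zero_or_one (fract_mem _) h'))
  push Not at hne
  have hx0' := lt_of_le_of_ne hx0 (Ne.symm hne.1)
  have hx1' := lt_of_le_of_ne hx1 hne.2
  rcases f_eq_cases hx with ⟨ex, hfx⟩ | ⟨ex, hfx⟩ | ⟨ex, hfx⟩ <;>
  rcases f_eq_cases hy with ⟨ey, hfy⟩ | ⟨ey, hfy⟩ | ⟨ey, hfy⟩ <;>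
  exact ⟨by linarith, by linarith⟩

lemma eq_of_f_eq {x y : ℝ} (hx : x ∈ Set.Ico (0 : ℝ) 1) (hy : y ∈ Set.Ico (0 : ℝ) 1)
    (h : f x = f y) (hirr : x ∉ Set.range ((↑) : ℚ → ℝ)) : x = y := by
  rw [← sub_eq_zero, ← abs_eq_zero]
  refine eq_zero_of_forall_three_pow_mul_le (abs_nonneg _) fun n => ?_
  induction n generalizing x y with
  | zero =>
    rw [pow_zero, one_mul, abs_le]; constructor <;> linarith [hx.1, hx.2, hy.1, hy.2]
  | succ n ih =>
    obtain ⟨hf, e⟩ := f_fract_eq_of_f_eq hx hy h hirr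
    have := ih (fract_mem _) (fract_mem _) hf (mt mem_range_ratCast_of_fract hirr)
    rw [e, abs_mul, abs_of_pos (by norm_num : (0 : ℝ) < 3)] at this
    rw [pow_succ]; linarith

lemma f_zero : f 0 = 0 := by simp [f, terDigit, phi]

lemma fract_three_halves : Int.fract (3 * (1 / 2) : ℝ) = 1 / 2 := by
  rw [Int.fract_eq_iff]
  exact ⟨by norm_num, by norm_num, 1, by norm_num⟩

lemma f_half : f (1 / 2) = 1 := by
  rcases f_eq_cases (x := 1 / 2) ⟨by norm_num, by norm_num⟩ with ⟨e, hf⟩ | ⟨e, hf⟩ | ⟨e, hf⟩ <;>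
  rw [fract_three_halves] at e hf <;> linarith

lemma f_two_thirds : f (2 / 3) = 1 / 3 := by
  have h : Int.fract (3 * (2 / 3) : ℝ) = 0 := by
    rw [Int.fract_eq_iff]
    exact ⟨by norm_num, by norm_num, 2, by norm_num⟩
  rcases f_eq_cases (x := 2 / 3) ⟨by norm_num, by norm_num⟩ with ⟨e, hf⟩ | ⟨e, hf⟩ | ⟨e, hf⟩ <;>
  rw [h] at e hf <;> linarith [f_zero]

lemma f_one_sixth : f (1 / 6) = 1 / 3 := by
  have h : Int.fract (3 * (1 / 6) : ℝ) = 1 / 2 := by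
    rw [Int.fract_eq_iff]
    exact ⟨by norm_num, by norm_num, 0, by norm_num⟩
  rcases f_eq_cases (x := 1 / 6) ⟨by norm_num, by norm_num⟩ with ⟨e, hf⟩ | ⟨e, hf⟩ | ⟨e, hf⟩ <;>
  rw [h] at e hf <;> linarith [f_half]

theorem stmt_4 :
    ({x ∈ Set.Ico (0:ℝ) 1 | ∃ y ∈ Set.Ico (0:ℝ) 1, y ≠ x ∧ f y = f x}).Nonempty ∧
    ({x ∈ Set.Ico (0:ℝ) 1 | ∃ y ∈ Set.Ico (0:ℝ) 1, y ≠ x ∧ f y = f x}).Countable := by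
  constructor
  · exact ⟨2 / 3, ⟨by norm_num, by norm_num⟩, 1 / 6, ⟨by norm_num, by norm_num⟩, by norm_num,
      f_one_sixth.trans f_two_thirds.symm⟩
  · refine (Set.countable_range ((↑) : ℚ → ℝ)).mono ?_
    rintro x ⟨hx, y, hy, hne, h⟩
    by_contra hirr
    exact hne (eq_of_f_eq hx hy h.symm hirr).symm
end

section
/- For every ternary-irrational x ∈ (0,1), f(x) − f(1 − x) = f01(x) − f12(x). -/
theorem terDigit_one_sub {x : ℝ} (hx : TernaryIrrational x) (n : ℕ) :
    terDigit n (1 - x) = 2 - terDigit n x := by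
  have hfloor : ⌊(3:ℝ)^(n+1) * (1 - x)⌋ = 3^(n+1) - 1 - ⌊(3:ℝ)^(n+1) * x⌋ := by
    have hlt : (⌊(3:ℝ)^(n+1) * x⌋ : ℝ) < (3:ℝ)^(n+1) * x :=
      lt_of_le_of_ne (Int.floor_le _) fun h => hx (n+1) ⟨_, h.symm⟩
    have hgt := Int.lt_floor_add_one ((3:ℝ)^(n+1) * x)
    rw [Int.floor_eq_iff]
    push_cast
    constructor <;> linarith
  have hpow : (3:ℤ)^(n+1) = 3 * 3^n := by ring
  unfold terDigit
  rw [hfloor, hpow]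
  omega

theorem summable_comp_terDigit_div (g : ℤ → ℝ) (x : ℝ) :
    Summable fun n : ℕ => g (terDigit n x) / 3^(n+1) := by
  have hgeom : Summable fun n : ℕ => (|g 0| + |g 1| + |g 2|) * (1/3:ℝ)^(n+1) :=
    ((summable_nat_add_iff 1).2
      (summable_geometric_of_lt_one (by norm_num) (by norm_num))).mul_left _
  refine hgeom.of_norm_bounded fun n => ?_
  have hdigit : terDigit n x = 0 ∨ terDigit n x = 1 ∨ terDigit n x = 2 := by
    unfold terDigit
    omega
  have hbound : |g (terDigit n x)| ≤ |g 0| + |g 1| + |g 2| := by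
    have h0 := abs_nonneg (g 0)
    have h1 := abs_nonneg (g 1)
    have h2 := abs_nonneg (g 2)
    rcases hdigit with h | h | h <;> rw [h] <;> linarith
  rw [Real.norm_eq_abs, abs_div, abs_of_pos (by positivity : (0:ℝ) < 3^(n+1)), one_div, inv_pow,
    ← div_eq_mul_inv]
  gcongr

theorem stmt_5 : ∀ x ∈ Set.Ioo (0:ℝ) 1, TernaryIrrational x →
    f x - f (1 - x) = f01 x - f12 x := by
  intro x _ hx
  unfold f f01 f12
  rw [← (summable_comp_terDigit_div phi x).tsum_sub (summable_comp_terDigit_div phi (1 - x)),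
    ← (summable_comp_terDigit_div phi01 x).tsum_sub (summable_comp_terDigit_div phi12 x)]
  refine tsum_congr fun n => ?_
  rw [terDigit_one_sub hx]
  unfold phi phi01 phi12
  push_cast
  ring
end

section
/- The function f is increasing (in the non-strict sense) on sets of points whose ternary representations agree up to some position and then have digit 0 versus a nonzero digit: if x₁, x₂ ∈ [0,1), n₀ ∈ ℕ, d_m(x₁) = d_m(x₂) for all m < n₀, d_{n₀}(x₁) = 0 and d_{n₀}(x₂) ∈ {1,2}, then x₁ < x₂ and f(x₁) ≤ f(x₂). -/
/-- Passing from `3 ^ n * x` to `3 ^ (n + 1) * x` appends the next ternary digit to the floor. -/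
theorem floor_pow_succ_mul (n : ℕ) (x : ℝ) :
    ⌊(3:ℝ)^(n+1) * x⌋ = 3 * ⌊(3:ℝ)^n * x⌋ + terDigit n x := by
  have hlo : 3 * ⌊(3:ℝ)^n * x⌋ ≤ ⌊(3:ℝ)^(n+1) * x⌋ := by
    rw [Int.le_floor]
    push_cast
    rw [pow_succ]
    linarith [Int.floor_le ((3:ℝ)^n * x)]
  have hhi : ⌊(3:ℝ)^(n+1) * x⌋ < 3 * ⌊(3:ℝ)^n * x⌋ + 3 := by
    rw [Int.floor_lt]
    push_cast
    rw [pow_succ]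
    linarith [Int.lt_floor_add_one ((3:ℝ)^n * x)]
  unfold terDigit
  omega

theorem floor_pow_mul_eq_of_terDigit_eq {x y : ℝ} (h0 : ⌊x⌋ = ⌊y⌋) (n : ℕ)
    (h : ∀ m < n, terDigit m x = terDigit m y) : ⌊(3:ℝ)^n * x⌋ = ⌊(3:ℝ)^n * y⌋ := by
  induction n with
  | zero => simpa using h0
  | succ n ih =>
    rw [floor_pow_succ_mul, floor_pow_succ_mul, ih fun m hm => h m (by omega), h n (by omega)]

theorem phi_terDigit_mem_Icc (n : ℕ) (x : ℝ) : phi (terDigit n x) ∈ Set.Icc (0:ℝ) 2 := by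
  have h : terDigit n x = 0 ∨ terDigit n x = 1 ∨ terDigit n x = 2 := by
    unfold terDigit
    omega
  rcases h with h | h | h <;> rw [h] <;> norm_num [phi]

theorem hasSum_two_div_three_pow : HasSum (fun n : ℕ => (2:ℝ) / 3^(n+1)) 1 := by
  have h := (hasSum_geometric_of_lt_one (r := (1/3:ℝ)) (by norm_num) (by norm_num)).mul_left (2/3)
  have hfun : (fun n : ℕ => (2:ℝ) / 3^(n+1)) = fun n => 2 / 3 * (1 / 3)^n := by
    ext n
    rw [div_pow, one_pow, pow_succ]
    field_simp
  rw [hfun]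
  norm_num at h ⊢
  exact h

theorem summable_div_three_pow {u : ℕ → ℝ} (hu : ∀ n, u n ∈ Set.Icc (0:ℝ) 2) :
    Summable fun n => u n / 3^(n+1) :=
  hasSum_two_div_three_pow.summable.of_nonneg_of_le
    (fun n => div_nonneg (hu n).1 (by positivity))
    fun n => div_le_div_of_nonneg_right (hu n).2 (by positivity)

/-- Lexicographic comparison of two base-three expansions with coefficients in `[0, 2]`. -/
theorem tsum_div_three_pow_le {u v : ℕ → ℝ} (hu : ∀ n, u n ∈ Set.Icc (0:ℝ) 2)
    (hv : ∀ n, v n ∈ Set.Icc (0:ℝ) 2) (n : ℕ) (h : ∀ m < n, u m = v m) (hn : u n + 1 ≤ v n) :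
    ∑' k, u k / 3^(k+1) ≤ ∑' k, v k / 3^(k+1) := by
  rw [← (summable_div_three_pow hu).sum_add_tsum_nat_add (n+1),
    ← (summable_div_three_pow hv).sum_add_tsum_nat_add (n+1),
    Finset.sum_range_succ, Finset.sum_range_succ]
  have hhead : ∑ k ∈ Finset.range n, u k / (3:ℝ)^(k+1) = ∑ k ∈ Finset.range n, v k / (3:ℝ)^(k+1) :=
    Finset.sum_congr rfl fun k hk => by rw [h k (Finset.mem_range.1 hk)]
  have htail : ∑' k, u (k+(n+1)) / (3:ℝ)^(k+(n+1)+1) ≤ 1 / 3^(n+1) := by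
    have hs := hasSum_two_div_three_pow.div_const ((3:ℝ)^(n+1))
    refine hasSum_le (fun k => ?_)
      ((summable_nat_add_iff (n+1)).2 (summable_div_three_pow hu)).hasSum hs
    rw [div_div, ← pow_add, show k + 1 + (n + 1) = k + (n + 1) + 1 by ring]
    exact div_le_div_of_nonneg_right (hu _).2 (by positivity)
  have hnonneg : 0 ≤ ∑' k, v (k+(n+1)) / (3:ℝ)^(k+(n+1)+1) :=
    tsum_nonneg fun k => div_nonneg (hv _).1 (by positivity)
  have hmid : u n / (3:ℝ)^(n+1) + 1 / 3^(n+1) ≤ v n / 3^(n+1) := by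
    rw [← add_div]
    exact div_le_div_of_nonneg_right hn (by positivity)
  linarith

theorem stmt_11 (x₁ x₂ : ℝ) (hx₁ : x₁ ∈ Set.Ico (0:ℝ) 1) (hx₂ : x₂ ∈ Set.Ico (0:ℝ) 1)
    (n₀ : ℕ) (hagree : ∀ m < n₀, terDigit m x₁ = terDigit m x₂)
    (h1 : terDigit n₀ x₁ = 0) (h2 : terDigit n₀ x₂ = 1 ∨ terDigit n₀ x₂ = 2) :
    x₁ < x₂ ∧ f x₁ ≤ f x₂ := by
  constructor
  · have h0 : ⌊x₁⌋ = ⌊x₂⌋ := by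
      rw [Int.floor_eq_zero_iff.2 hx₁, Int.floor_eq_zero_iff.2 hx₂]
    have heq := floor_pow_mul_eq_of_terDigit_eq h0 n₀ hagree
    have hlt : ⌊(3:ℝ)^(n₀+1) * x₁⌋ < ⌊(3:ℝ)^(n₀+1) * x₂⌋ := by
      rw [floor_pow_succ_mul, floor_pow_succ_mul]
      omega
    exact lt_of_mul_lt_mul_left (Int.floor_mono.reflect_lt hlt) (by positivity)
  · refine tsum_div_three_pow_le (fun n => phi_terDigit_mem_Icc n x₁)
      (fun n => phi_terDigit_mem_Icc n x₂) n₀ (fun m hm => by rw [hagree m hm]) ?_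
    rcases h2 with h2 | h2 <;> rw [h1, h2] <;> norm_num [phi]
end

section
/- The function f is continuous at every ternary-irrational point: if x ∈ (0,1) and 3^n x ∉ ℤ for all n ∈ ℕ, then f (regarded as the function ℝ → ℝ given by x ↦ ∑_{n≥0} φ(⌊3^{n+1} x⌋ mod 3)/3^{n+1}) is continuous at x. -/
theorem abs_phi_emod_three_le (k : ℤ) : |phi (k % 3)| ≤ 2 := by
  have h : k % 3 = 0 ∨ k % 3 = 1 ∨ k % 3 = 2 := by omega
  rcases h with h | h | h <;> rw [h, phi] <;> norm_num

theorem eventually_floor_eq {y : ℝ} (hy : ¬ ∃ k : ℤ, y = (k : ℝ)) :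
    ∀ᶠ z in nhds y, ⌊z⌋ = ⌊y⌋ := by
  have hlt : (⌊y⌋ : ℝ) < y := lt_of_le_of_ne (Int.floor_le y) fun h => hy ⟨_, h.symm⟩
  filter_upwards [Ioo_mem_nhds hlt (Int.lt_floor_add_one y)] with z hz
  exact Int.floor_eq_iff.2 ⟨hz.1.le, hz.2⟩

theorem TernaryIrrational.eventually_terDigit_eq {x : ℝ} (hx : TernaryIrrational x) (n : ℕ) :
    ∀ᶠ y in nhds x, terDigit n y = terDigit n x := by
  have hc : Filter.Tendsto (fun y : ℝ => (3 : ℝ) ^ (n + 1) * y) (nhds x)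
      (nhds ((3 : ℝ) ^ (n + 1) * x)) := (continuous_const_mul _).tendsto x
  filter_upwards [hc.eventually (eventually_floor_eq (hx (n + 1)))] with y hy
  rw [terDigit, terDigit, hy]

theorem stmt_13 : ∀ x ∈ Set.Ioo (0:ℝ) 1, TernaryIrrational x → ContinuousAt f x := by
  intro x _ hx
  have hs : Summable fun n : ℕ => (2 : ℝ) / 3 ^ (n + 1) := by
    have h := (summable_geometric_of_lt_one (r := (1 / 3 : ℝ)) (by norm_num)
      (by norm_num)).mul_left (2 / 3)
    refine h.congr fun n => ?_
    rw [div_pow, one_pow, pow_succ]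
    field_simp
  refine tendsto_tsum_of_dominated_convergence hs (fun n => ?_) (.of_forall fun y n => ?_)
  · refine tendsto_const_nhds.congr' ?_
    filter_upwards [hx.eventually_terDigit_eq n] with y hy
    rw [hy]
  · rw [Real.norm_eq_abs, abs_div, abs_of_pos (show (0 : ℝ) < 3 ^ (n + 1) by positivity)]
    gcongr
    exact abs_phi_emod_three_le _
end

section
/- The function f is nowhere differentiable: for every x ∈ (0,1), f (regarded as the function ℝ → ℝ given by x ↦ ∑_{n≥0} φ(⌊3^{n+1} x⌋ mod 3)/3^{n+1}) is not differentiable at x. -/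
lemma terDigit_mem (n : ℕ) (x : ℝ) : terDigit n x = 0 ∨ terDigit n x = 1 ∨ terDigit n x = 2 := by
  unfold terDigit
  omega

lemma abs_phi_terDigit_le (n : ℕ) (x : ℝ) : |phi (terDigit n x)| ≤ 2 := by
  rcases terDigit_mem n x with h | h | h <;> rw [h] <;> norm_num [phi]

/-- Adding `c / 3 ^ (n + 1)` adds `c` to the `n`-th digit if there is no carry. -/
lemma terDigit_add_self {n : ℕ} {x : ℝ} {c : ℤ} (h0 : 0 ≤ terDigit n x + c)
    (h2 : terDigit n x + c ≤ 2) : terDigit n (x + c / 3 ^ (n + 1)) = terDigit n x + c := by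
  unfold terDigit at *
  rw [mul_add, mul_div_cancel₀ _ (by positivity), Int.floor_add_intCast]
  omega

/-- Adding `c / 3 ^ (n + 1)` without a carry leaves the other digits unchanged. -/
lemma terDigit_add_of_ne {m n : ℕ} {x : ℝ} {c : ℤ} (h0 : 0 ≤ terDigit n x + c)
    (h2 : terDigit n x + c ≤ 2) (hmn : m ≠ n) :
    terDigit m (x + c / 3 ^ (n + 1)) = terDigit m x := by
  unfold terDigit at *
  rcases lt_or_gt_of_ne hmn with h | h
  · obtain ⟨k, rfl⟩ := Nat.exists_eq_add_of_lt h
    have key (y : ℝ) : ⌊(3 : ℝ) ^ (m + 1) * y⌋ = ⌊(3 : ℝ) ^ (m + k + 1 + 1) * y⌋ / 3 / 3 ^ k := by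
      have := Int.floor_div_natCast ((3 : ℝ) ^ (m + k + 1 + 1) * y) (3 * 3 ^ k)
      rw [Int.ediv_ediv_of_nonneg (by norm_num)]
      push_cast at this
      rw [← this]
      congr 1
      field_simp
      ring
    rw [key, key x, mul_add, mul_div_cancel₀ _ (by positivity), Int.floor_add_intCast]
    congr 2
    omega
  · obtain ⟨k, rfl⟩ := Nat.exists_eq_add_of_lt h
    have : (3 : ℝ) ^ (n + k + 1 + 1) * (x + c / 3 ^ (n + 1))
        = 3 ^ (n + k + 1 + 1) * x + ((3 * (3 ^ k * c) : ℤ) : ℝ) := by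
      push_cast
      field_simp
      ring
    rw [this, Int.floor_add_intCast]
    omega

lemma f_add_sub {n : ℕ} {x : ℝ} {c : ℤ} (h0 : 0 ≤ terDigit n x + c)
    (h2 : terDigit n x + c ≤ 2) :
    f (x + c / 3 ^ (n + 1)) - f x = (phi (terDigit n x + c) - phi (terDigit n x)) / 3 ^ (n + 1) := by
  unfold f
  rw [← (summable_phi_terDigit _).tsum_sub (summable_phi_terDigit x), tsum_eq_single n,
    terDigit_add_self h0 h2, sub_div]
  intro m hm
  rw [terDigit_add_of_ne h0 h2 hm, sub_self]

theorem stmt_15 : ∀ x ∈ Set.Ioo (0:ℝ) 1, ¬ DifferentiableAt ℝ f x := by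
  intro x _ hd
  have hev := (hasDerivAt_iff_isLittleO.1 hd.hasDerivAt).bound (by norm_num : (0 : ℝ) < 1 / 4)
  generalize deriv f x = L at hev
  obtain ⟨δ, hδ, hball⟩ := Metric.eventually_nhds_iff.1 hev
  obtain ⟨n, hn⟩ := exists_pow_lt_of_lt_one (half_pos hδ) (by norm_num : (1 / 3 : ℝ) < 1)
  have hp : (0 : ℝ) < 3 ^ (n + 1) := by positivity
  have hsmall : 2 / (3 : ℝ) ^ (n + 1) < δ := by
    have : 2 / (3 : ℝ) ^ (n + 1) = 2 / 3 * (1 / 3) ^ n := by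
      rw [pow_succ, one_div, inv_pow]
      field_simp
    have hpos : (0 : ℝ) < (1 / 3) ^ n := by positivity
    linarith
  have key (c : ℤ) (h0 : 0 ≤ terDigit n x + c) (h2 : terDigit n x + c ≤ 2) :
      |phi (terDigit n x + c) - phi (terDigit n x) - c * L| ≤ 1 / 4 * |(c : ℝ)| := by
    have hc : |(c : ℝ)| ≤ 2 := by
      have : |c| ≤ 2 := by
        rw [abs_le]
        rcases terDigit_mem n x with h | h | h <;> omega
      exact_mod_cast this
    have hb := @hball (x + c / 3 ^ (n + 1)) (by
      rw [Real.dist_eq, add_sub_cancel_left, abs_div, abs_of_pos hp]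
      exact (div_le_div_of_nonneg_right hc hp.le).trans_lt hsmall)
    rw [f_add_sub h0 h2, add_sub_cancel_left, smul_eq_mul, div_mul_eq_mul_div, ← sub_div,
      Real.norm_eq_abs, Real.norm_eq_abs, abs_div, abs_div, abs_of_pos hp, ← mul_div_assoc] at hb
    exact (div_le_div_iff_of_pos_right hp).1 hb
  rcases terDigit_mem n x with h | h | h <;> rw [h] at key
  · have h1 := key 1 (by norm_num) (by norm_num)
    have h2 := key 2 (by norm_num) (by norm_num)
    norm_num [phi, abs_le] at h1 h2
    linarith
  · have h1 := key 1 (by norm_num) (by norm_num)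
    have h2 := key (-1) (by norm_num) (by norm_num)
    norm_num [phi, abs_le] at h1 h2
    linarith
  · have h1 := key (-1) (by norm_num) (by norm_num)
    have h2 := key (-2) (by norm_num) (by norm_num)
    norm_num [phi, abs_le] at h1 h2
    linarith
end

section
/- The Lebesgue integral of f over [0,1] is equal to 1/2: ∫_{[0,1)} f(x) dx = 1/2 with respect to Lebesgue measure. -/
lemma phi_emod_bounds (k : ℤ) : 0 ≤ phi (k % 3) ∧ phi (k % 3) ≤ 2 := by
  have h : k % 3 = 0 ∨ k % 3 = 1 ∨ k % 3 = 2 := by lia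
  rcases h with h | h | h <;> rw [h] <;> norm_num [phi]

lemma measurable_phi_floor_emod : Measurable fun z : ℝ => phi (⌊z⌋ % 3) :=
  (measurable_from_top (f := fun k : ℤ => phi (k % 3))).comp Int.measurable_floor

lemma intervalIntegrable_phi_floor_emod (a b : ℝ) :
    IntervalIntegrable (fun z : ℝ => phi (⌊z⌋ % 3)) MeasureTheory.volume a b := by
  refine (intervalIntegrable_const (c := (2 : ℝ))).mono_fun
    measurable_phi_floor_emod.aestronglyMeasurable (Filter.Eventually.of_forall fun z => ?_)
  have := phi_emod_bounds ⌊z⌋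
  simpa [abs_of_nonneg this.1] using this.2

lemma periodic_phi_floor_emod : Function.Periodic (fun z : ℝ => phi (⌊z⌋ % 3)) 3 := by
  intro z
  have h : ⌊z + 3⌋ = ⌊z⌋ + 3 := by exact_mod_cast Int.floor_add_intCast z 3
  simp [h]

lemma integral_phi_floor_emod_unit (k : ℤ) :
    ∫ z in (k : ℝ)..(k + 1), phi (⌊z⌋ % 3) = phi (k % 3) := by
  have h : ∫ z in (k : ℝ)..(k + 1), phi (⌊z⌋ % 3) = ∫ _z in (k : ℝ)..(k + 1), phi (k % 3) := by
    rw [intervalIntegral.integral_of_le (by linarith), intervalIntegral.integral_of_le (by linarith),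
      ← MeasureTheory.integral_Ico_eq_integral_Ioc, ← MeasureTheory.integral_Ico_eq_integral_Ioc]
    refine MeasureTheory.setIntegral_congr_fun measurableSet_Ico fun z hz => ?_
    simp only [Int.floor_eq_iff.2 hz]
  simp [h]

lemma integral_phi_floor_emod_period : ∫ z in (0 : ℝ)..3, phi (⌊z⌋ % 3) = 3 := by
  have h0 := integral_phi_floor_emod_unit 0
  have h1 := integral_phi_floor_emod_unit 1
  have h2 := integral_phi_floor_emod_unit 2
  norm_num [phi] at h0 h1 h2
  rw [← intervalIntegral.integral_add_adjacent_intervals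
      (intervalIntegrable_phi_floor_emod 0 1) (intervalIntegrable_phi_floor_emod 1 3),
    ← intervalIntegral.integral_add_adjacent_intervals
      (intervalIntegrable_phi_floor_emod 1 2) (intervalIntegrable_phi_floor_emod 2 3)]
  norm_num [phi, h0, h1, h2]

lemma integral_phi_terDigit (n : ℕ) : ∫ x in Set.Ico (0 : ℝ) 1, phi (terDigit n x) = 1 := by
  have hp := periodic_phi_floor_emod.intervalIntegral_add_zsmul_eq ((3 : ℤ) ^ n) 0
    intervalIntegrable_phi_floor_emod
  rw [zero_add, zero_add, integral_phi_floor_emod_period] at hp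
  rw [MeasureTheory.integral_Ico_eq_integral_Ioc, ← intervalIntegral.integral_of_le zero_le_one]
  unfold terDigit
  rw [intervalIntegral.integral_comp_mul_left (fun z : ℝ => phi (⌊z⌋ % 3)) (by positivity)]
  have h3 : ((3 : ℤ) ^ n) • (3 : ℝ) = 3 ^ (n + 1) := by simp [pow_succ]
  rw [h3] at hp
  rw [mul_zero, mul_one, hp]
  exact inv_mul_cancel₀ (by positivity)

lemma integrableOn_phi_terDigit (n : ℕ) :
    MeasureTheory.IntegrableOn (fun x => phi (terDigit n x)) (Set.Ico 0 1) := by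
  by_contra h
  have := integral_phi_terDigit n
  rw [MeasureTheory.integral_undef h] at this
  exact zero_ne_one this

theorem stmt_19 : ∫ x in Set.Ico (0:ℝ) 1, f x = 1/2 := by
  have hterm (n : ℕ) :
      ∫ x in Set.Ico (0 : ℝ) 1, phi (terDigit n x) / 3 ^ (n + 1) = (1 / 3) ^ n * (1 / 3) := by
    rw [MeasureTheory.integral_div, integral_phi_terDigit, ← pow_succ, div_pow, one_pow]
  have hgeom : HasSum (fun n : ℕ => (1 / 3 : ℝ) ^ n * (1 / 3)) (1 / 2) := by
    have h := (hasSum_geometric_of_lt_one (r := (1 / 3 : ℝ)) (by norm_num) (by norm_num)).mul_right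
      (1 / 3)
    rwa [show (1 - 1 / 3 : ℝ)⁻¹ * (1 / 3) = 1 / 2 by norm_num] at h
  have hnorm (n : ℕ) (x : ℝ) :
      ‖phi (terDigit n x) / 3 ^ (n + 1)‖ = phi (terDigit n x) / 3 ^ (n + 1) :=
    Real.norm_of_nonneg (div_nonneg (phi_emod_bounds _).1 (by positivity))
  unfold f
  rw [← MeasureTheory.integral_tsum_of_summable_integral_norm
    (fun n => (integrableOn_phi_terDigit n).div_const _)]
  · simp_rw [hterm]
    exact hgeom.tsum_eq
  · simp_rw [hnorm, hterm]
    exact hgeom.summable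
end
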